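/- (Proposition 3.2) For every p ∈ M⁴ one has ∇F(p) ≠ 0; moreover, the gradients ∇F(p) and ∇G(p) are linearly dependent if and only if p ∈ ℓ₋ ∪ ℓ₊. Consequently, at every point of M̃⁴ = M⁴ \ (ℓ₋ ∪ ℓ₊) the gradients ∇F and ∇G are linearly independent (so M̃⁴ is a regular 4-dimensional submanifold of ℝ⁶, and ℓ₋ ∪ ℓ₊ is the singular set of M⁴). -/

import Mathlib

noncomputable section

/-- `ℝ⁶` with its Euclidean inner product; coordinates `p 0, p 1, p 2` are `x₁, x₂, x₃`
and `p 3, p 4, p 5` are `y₁, y₂, y₃`. -/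
abbrev E6 := EuclideanSpace ℝ (Fin 6)

/-- The point of `ℝ⁶` with the given six coordinates. -/
noncomputable def mk6 (a b c d e f : ℝ) : E6 :=
  (EuclideanSpace.equiv (Fin 6) ℝ).symm ![a, b, c, d, e, f]

/-- The polynomial `F` of Proposition 3.2. -/
noncomputable def Fq (p : E6) : ℝ :=
  9 * (p 0) ^ 2 * (p 2) ^ 8 * ((p 1) ^ 2 + (p 2) ^ 2) * (p 3) ^ 2
    + 9 * (p 0) ^ 8 * (p 1) ^ 2 * ((p 0) ^ 2 - (p 2) ^ 2) * (p 4) ^ 2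
    - 9 * (p 1) ^ 8 * (p 2) ^ 2 * ((p 0) ^ 2 + (p 1) ^ 2) * (p 5) ^ 2
    - (p 0) ^ 2 * (p 1) ^ 2 * (p 2) ^ 2 *
      (2 * (p 0) ^ 2 * (p 1) ^ 4 - 2 * (p 0) ^ 2 * (p 2) ^ 4 - 2 * (p 1) ^ 2 * (p 2) ^ 4
        - (p 0) ^ 2 * (p 1) ^ 2 * (p 2) ^ 2)

/-- The polynomial `G` of Proposition 3.2. -/
noncomputable def Gq (p : E6) : ℝ := (p 1) ^ 2 - (p 0) ^ 2 - (p 2) ^ 2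

/-- The algebraic variety `M⁴`. -/
def M4 : Set E6 :=
  {p | Fq p = 0 ∧ Gq p = 0 ∧ 0 < p 0 ∧ 0 < p 1 ∧ 0 < p 2 ∧ ¬(p 3 = 0 ∧ p 4 = 0 ∧ p 5 = 0)}

/-- The half line `ℓ₊`: points of `M⁴` with `x = s(1, √2, 1)`, `s > 0`, `y = (0, 1, 0)`. -/
def ellP : Set E6 :=
  {p ∈ M4 | ∃ s : ℝ, 0 < s ∧ p 0 = s ∧ p 1 = s * Real.sqrt 2 ∧ p 2 = s ∧
    p 3 = 0 ∧ p 4 = 1 ∧ p 5 = 0}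

/-- The half line `ℓ₋`: points of `M⁴` with `x = s(1, √2, 1)`, `s > 0`, `y = (0, -1, 0)`. -/
def ellM : Set E6 :=
  {p ∈ M4 | ∃ s : ℝ, 0 < s ∧ p 0 = s ∧ p 1 = s * Real.sqrt 2 ∧ p 2 = s ∧
    p 3 = 0 ∧ p 4 = -1 ∧ p 5 = 0}

/-- The regular part `M̃⁴ = M⁴ \ (ℓ₋ ∪ ℓ₊)`. -/
def Mt4 : Set E6 := M4 \ (ellM ∪ ellP)

/-- `A₁` of Proposition 3.3. -/
noncomputable def A1 (p : E6) : ℝ :=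
  (1 / (p 1) ^ 4) * (3 * (p 1) ^ 4 - (p 2) ^ 4) * (p 3) ^ 2
    - ((p 0) ^ 6 / (p 2) ^ 8) * (3 * (p 0) ^ 2 - 2 * (p 2) ^ 2) * (p 4) ^ 2
    + ((p 1) ^ 4 / ((p 0) ^ 2 * (p 2) ^ 4)) * (3 * (p 0) ^ 2 + 2 * (p 1) ^ 2) * (p 5) ^ 2
    + (1 / (9 * (p 2) ^ 4)) * (5 * (p 0) ^ 4 + 2 * (p 1) ^ 2 * (p 2) ^ 2)

/-- `A₂` of Proposition 3.3. -/
noncomputable def A2 (p : E6) : ℝ :=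
  -((p 2) ^ 4 / ((p 0) ^ 4 * (p 1) ^ 2)) * (3 * (p 1) ^ 2 + 2 * (p 2) ^ 2) * (p 3) ^ 2
    - (1 / (p 2) ^ 4) * ((p 0) ^ 4 - 3 * (p 2) ^ 4) * (p 4) ^ 2
    - ((p 1) ^ 6 / (p 0) ^ 8) * (2 * (p 0) ^ 2 + 3 * (p 1) ^ 2) * (p 5) ^ 2
    - (1 / (9 * (p 0) ^ 4)) * (5 * (p 1) ^ 4 - 2 * (p 0) ^ 2 * (p 2) ^ 2)

/-- `A₃` of Proposition 3.3. -/
noncomputable def A3 (p : E6) : ℝ :=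
  ((p 2) ^ 6 / (p 1) ^ 8) * (2 * (p 1) ^ 2 + 3 * (p 2) ^ 2) * (p 3) ^ 2
    + ((p 0) ^ 4 / ((p 1) ^ 4 * (p 2) ^ 2)) * (2 * (p 0) ^ 2 - 3 * (p 2) ^ 2) * (p 4) ^ 2
    + (1 / (p 0) ^ 4) * (3 * (p 0) ^ 4 - (p 1) ^ 4) * (p 5) ^ 2
    + (1 / (9 * (p 1) ^ 4)) * (5 * (p 2) ^ 4 + 2 * (p 0) ^ 2 * (p 1) ^ 2)

/-- The vector field `X₁` of Proposition 3.3. -/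
noncomputable def X1 (p : E6) : E6 :=
  mk6 ((1 / (p 1) ^ 4) * (((p 1) ^ 4 + (p 1) ^ 2 * (p 2) ^ 2 + (p 2) ^ 4) * p 0 * p 3))
      ((1 / (p 1) ^ 4) * ((p 1) ^ 5 * p 3))
      ((1 / (p 1) ^ 4) * ((p 2) ^ 5 * p 3))
      ((1 / (p 1) ^ 4) * ((p 1) ^ 4 * A1 p))
      ((1 / (p 1) ^ 4) * (2 * (p 0) ^ 2 * (p 1) ^ 2 * p 3 * p 4))
      ((1 / (p 1) ^ 4) * ((8 * (p 2) ^ 2 + 2 * (p 0) ^ 2) * (p 2) ^ 2 * p 3 * p 5))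

/-- The vector field `X₂` of Proposition 3.3. -/
noncomputable def X2 (p : E6) : E6 :=
  mk6 ((1 / (p 2) ^ 4) * ((p 0) ^ 5 * p 4))
      ((1 / (p 2) ^ 4) * (((p 0) ^ 4 - (p 0) ^ 2 * (p 2) ^ 2 + (p 2) ^ 4) * p 1 * p 4))
      ((1 / (p 2) ^ 4) * ((p 2) ^ 5 * p 4))
      ((1 / (p 2) ^ 4) * ((8 * (p 0) ^ 2 - 2 * (p 1) ^ 2) * (p 0) ^ 2 * p 3 * p 4))
      ((1 / (p 2) ^ 4) * ((p 2) ^ 4 * A2 p))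
      ((1 / (p 2) ^ 4) * (2 * (p 1) ^ 2 * (p 2) ^ 2 * p 4 * p 5))

/-- The vector field `X₃` of Proposition 3.3. -/
noncomputable def X3 (p : E6) : E6 :=
  mk6 ((1 / (p 0) ^ 4) * ((p 0) ^ 5 * p 5))
      ((1 / (p 0) ^ 4) * ((p 1) ^ 5 * p 5))
      ((1 / (p 0) ^ 4) * (((p 0) ^ 4 + (p 0) ^ 2 * (p 1) ^ 2 + (p 1) ^ 4) * p 2 * p 5))
      ((1 / (p 0) ^ 4) * (-2 * (p 0) ^ 2 * (p 2) ^ 2 * p 3 * p 5))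
      ((1 / (p 0) ^ 4) * ((8 * (p 1) ^ 2 - 2 * (p 2) ^ 2) * (p 1) ^ 2 * p 4 * p 5))
      ((1 / (p 0) ^ 4) * ((p 0) ^ 4 * A3 p))

/-- The indexed family `X₁, X₂, X₃`. -/
noncomputable def Xv : Fin 3 → E6 → E6 := ![X1, X2, X3]

/-- The coordinates of a gradient are the partial derivatives. -/
theorem gradient_apply_of_hasFDerivAt {n : ℕ} {f : EuclideanSpace ℝ (Fin n) → ℝ}
    {f' : EuclideanSpace ℝ (Fin n) →L[ℝ] ℝ} {p : EuclideanSpace ℝ (Fin n)}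
    (h : HasFDerivAt f f' p) (i : Fin n) :
    gradient f p i = f' (EuclideanSpace.single i 1) := by
  have h1 : inner ℝ (gradient f p) (EuclideanSpace.single i (1 : ℝ))
      = f' (EuclideanSpace.single i 1) := by
    rw [gradient, InnerProductSpace.toDual_symm_apply, h.fderiv]
  rw [← h1, EuclideanSpace.inner_single_right]
  simp

theorem hasFDerivAt_coord {n : ℕ} (p : EuclideanSpace ℝ (Fin n)) (i : Fin n) :
    HasFDerivAt (fun q : EuclideanSpace ℝ (Fin n) => q i)
      (EuclideanSpace.proj i : EuclideanSpace ℝ (Fin n) →L[ℝ] ℝ) p :=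
  (EuclideanSpace.proj i : EuclideanSpace ℝ (Fin n) →L[ℝ] ℝ).hasFDerivAt

theorem gradient_Gq (p : E6) : gradient Gq p = mk6 (-2 * p 0) (2 * p 1) (-2 * p 2) 0 0 0 := by
  have c := hasFDerivAt_coord p
  have h : HasFDerivAt Gq _ p := (((c 1).pow 2).sub ((c 0).pow 2)).sub ((c 2).pow 2)
  ext i
  rw [gradient_apply_of_hasFDerivAt h]
  fin_cases i <;> simp [mk6]

theorem gradient_Fq (p : E6) : gradient Fq p = mk6
    (18 * p 0 * p 2 ^ 8 * (p 1 ^ 2 + p 2 ^ 2) * p 3 ^ 2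
      + 18 * p 0 ^ 7 * p 1 ^ 2 * (5 * p 0 ^ 2 - 4 * p 2 ^ 2) * p 4 ^ 2
      - 18 * p 0 * p 1 ^ 8 * p 2 ^ 2 * p 5 ^ 2
      - 2 * p 0 * p 1 ^ 2 * p 2 ^ 2 * (4 * p 0 ^ 2 * p 1 ^ 4 - 4 * p 0 ^ 2 * p 2 ^ 4
        - 2 * p 1 ^ 2 * p 2 ^ 4 - 2 * p 0 ^ 2 * p 1 ^ 2 * p 2 ^ 2))
    (18 * p 0 ^ 2 * p 1 * p 2 ^ 8 * p 3 ^ 2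
      + 18 * p 0 ^ 8 * p 1 * (p 0 ^ 2 - p 2 ^ 2) * p 4 ^ 2
      - 18 * p 1 ^ 7 * p 2 ^ 2 * (4 * p 0 ^ 2 + 5 * p 1 ^ 2) * p 5 ^ 2
      - 2 * p 0 ^ 2 * p 1 * p 2 ^ 2 * (6 * p 0 ^ 2 * p 1 ^ 4 - 2 * p 0 ^ 2 * p 2 ^ 4
        - 4 * p 1 ^ 2 * p 2 ^ 4 - 2 * p 0 ^ 2 * p 1 ^ 2 * p 2 ^ 2))
    (18 * p 0 ^ 2 * p 2 ^ 7 * (4 * p 1 ^ 2 + 5 * p 2 ^ 2) * p 3 ^ 2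
      - 18 * p 0 ^ 8 * p 1 ^ 2 * p 2 * p 4 ^ 2
      - 18 * p 1 ^ 8 * p 2 * (p 0 ^ 2 + p 1 ^ 2) * p 5 ^ 2
      - 2 * p 0 ^ 2 * p 1 ^ 2 * p 2 * (2 * p 0 ^ 2 * p 1 ^ 4 - 6 * p 0 ^ 2 * p 2 ^ 4
        - 6 * p 1 ^ 2 * p 2 ^ 4 - 2 * p 0 ^ 2 * p 1 ^ 2 * p 2 ^ 2))
    (18 * p 0 ^ 2 * p 2 ^ 8 * (p 1 ^ 2 + p 2 ^ 2) * p 3)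
    (18 * p 0 ^ 8 * p 1 ^ 2 * (p 0 ^ 2 - p 2 ^ 2) * p 4)
    (-18 * p 1 ^ 8 * p 2 ^ 2 * (p 0 ^ 2 + p 1 ^ 2) * p 5) := by
  have c := hasFDerivAt_coord p
  have h : HasFDerivAt Fq _ p :=
    ((((((((c 0).pow 2).const_mul 9).mul ((c 2).pow 8)).mul
            (((c 1).pow 2).add ((c 2).pow 2))).mul ((c 3).pow 2)).add
        ((((((c 0).pow 8).const_mul 9).mul ((c 1).pow 2)).mul
            (((c 0).pow 2).sub ((c 2).pow 2))).mul ((c 4).pow 2))).sub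
        ((((((c 1).pow 8).const_mul 9).mul ((c 2).pow 2)).mul
            (((c 0).pow 2).add ((c 1).pow 2))).mul ((c 5).pow 2))).sub
        (((((c 0).pow 2).mul ((c 1).pow 2)).mul ((c 2).pow 2)).mul
          (((((((c 0).pow 2).const_mul 2).mul ((c 1).pow 4)).sub
              ((((c 0).pow 2).const_mul 2).mul ((c 2).pow 4))).sub
              ((((c 1).pow 2).const_mul 2).mul ((c 2).pow 4))).sub
              ((((c 0).pow 2).mul ((c 1).pow 2)).mul ((c 2).pow 2))))
  ext i
  rw [gradient_apply_of_hasFDerivAt h]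
  fin_cases i <;> simp [mk6] <;> ring

theorem gradient_Gq_ne_zero {p : E6} (h0 : 0 < p 0) : gradient Gq p ≠ 0 := by
  intro h
  have h1 := congrArg (fun q : E6 => q 0) h
  simp [gradient_Gq, mk6] at h1
  exact h0.ne' h1

/-- Where `∇F` is a multiple of `∇G` on `M⁴`, the point lies on `ℓ₋ ∪ ℓ₊` and the multiple is
nonzero. -/
theorem mem_ell_of_gradient_eq_smul {p : E6} (hp : p ∈ M4) {l : ℝ}
    (h : gradient Fq p = l • gradient Gq p) : p ∈ ellM ∪ ellP ∧ l ≠ 0 := by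
  obtain ⟨-, hG, h0, h1, h2, hy⟩ := id hp
  rw [gradient_Fq, gradient_Gq] at h
  have e (i : Fin 6) := congrArg (fun q : E6 => q i) h
  have e0 := e 0
  have e1 := e 1
  have e3 := e 3
  have e4 := e 4
  have e5 := e 5
  simp only [mk6] at e0 e1 e3 e4 e5
  simp at e0 e1 e3 e4 e5
  have n3 : p 1 ^ 2 + p 2 ^ 2 ≠ 0 := by positivity
  have n5 : p 0 ^ 2 + p 1 ^ 2 ≠ 0 := by positivity
  have y3 : p 3 = 0 := by simpa [h0.ne', h2.ne', n3] using e3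
  have y5 : p 5 = 0 := by simpa [h1.ne', h2.ne', n5] using e5
  have y4 : p 4 ≠ 0 := fun y4 => hy ⟨y3, y4, y5⟩
  have q : p 0 ^ 2 - p 2 ^ 2 = 0 := by simpa [h0.ne', h1.ne', y4] using e4
  have x2 : p 2 = p 0 := by nlinarith
  have x1 : p 1 ^ 2 = 2 * p 0 ^ 2 := by unfold Gq at hG; linarith
  have x1' : p 1 = p 0 * √2 := by
    rw [← Real.sqrt_sq h1.le, x1, mul_comm, Real.sqrt_mul (sq_nonneg _), Real.sqrt_sq h0.le]
  have hl : l = -10 * p 0 ^ 10 := by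
    have k : p 1 * 2 * (l + 10 * p 0 ^ 10) = 0 := by
      rw [x2, y3, y5] at e1
      linear_combination -e1 +
        (-(12 * p 0 ^ 6 * p 1) * (p 1 ^ 2 + 2 * p 0 ^ 2) + 12 * p 0 ^ 8 * p 1) * x1
    have := (mul_eq_zero.mp k).resolve_left (by positivity)
    linarith
  have hv : p 4 ^ 2 = 1 := by
    have k : 36 * p 0 ^ 11 * (p 4 ^ 2 - 1) = 0 := by
      rw [x2, y3, y5, hl] at e0
      have x14 : p 1 ^ 4 = 4 * p 0 ^ 4 := by
        rw [show p 1 ^ 4 = (p 1 ^ 2) ^ 2 by ring, x1]; ring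
      rw [x14, x1] at e0
      linear_combination e0
    have := (mul_eq_zero.mp k).resolve_left (by positivity)
    linarith
  refine ⟨?_, by rw [hl]; exact mul_ne_zero (by norm_num) (by positivity)⟩
  rcases sq_eq_sq_iff_eq_or_eq_neg.mp (hv.trans (one_pow 2).symm) with hv | hv
  · exact Or.inr ⟨hp, p 0, h0, rfl, x1', x2, y3, hv, y5⟩
  · exact Or.inl ⟨hp, p 0, h0, rfl, x1', x2, y3, hv, y5⟩

theorem gradient_eq_smul_of_mem_ell {p : E6} (hp : p ∈ ellM ∪ ellP) :
    gradient Fq p = (-10 * p 0 ^ 10) • gradient Gq p := by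
  have key : p 2 = p 0 ∧ p 1 ^ 2 = 2 * p 0 ^ 2 ∧ p 3 = 0 ∧ p 4 ^ 2 = 1 ∧ p 5 = 0 := by
    have hs : √2 ^ 2 = (2 : ℝ) := Real.sq_sqrt (by norm_num)
    rcases hp with ⟨-, s, -, h0, h1, h2, h3, h4, h5⟩ | ⟨-, s, -, h0, h1, h2, h3, h4, h5⟩ <;>
    · refine ⟨h2.trans h0.symm, ?_, h3, ?_, h5⟩
      · rw [h1, h0, mul_pow, hs, mul_comm]
      · rw [h4]; norm_num
  obtain ⟨x2, x1, y3, y4, y5⟩ := key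
  have x14 : p 1 ^ 4 = 4 * p 0 ^ 4 := by
    rw [show p 1 ^ 4 = (p 1 ^ 2) ^ 2 by ring, x1]; ring
  rw [gradient_Fq, gradient_Gq, x2, y3, y4, y5, x14, x1]
  ext i
  fin_cases i <;> simp [mk6] <;> ring

/-- A linear relation between the gradients makes `∇F` a multiple of `∇G`, since `∇G ≠ 0`. -/
theorem gradient_eq_smul_of_relation {p : E6} (h0 : 0 < p 0) {a b : ℝ}
    (hab : ¬(a = 0 ∧ b = 0)) (h : a • gradient Fq p + b • gradient Gq p = 0) :
    gradient Fq p = (-(a⁻¹ * b)) • gradient Gq p := by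
  have ha : a ≠ 0 := by
    rintro rfl
    rw [zero_smul, zero_add] at h
    exact hab ⟨rfl, (smul_eq_zero.mp h).resolve_right (gradient_Gq_ne_zero h0)⟩
  rw [← inv_smul_smul₀ ha (gradient Fq p), eq_neg_of_add_eq_zero_left h, smul_neg, smul_smul,
    neg_smul]

theorem gradient_relation_iff_mem_ell {p : E6} (hp : p ∈ M4) :
    (∃ a b : ℝ, ¬(a = 0 ∧ b = 0) ∧ a • gradient Fq p + b • gradient Gq p = 0) ↔
      p ∈ ellM ∪ ellP := by
  constructor
  · rintro ⟨a, b, hab, h⟩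
    exact (mem_ell_of_gradient_eq_smul hp (gradient_eq_smul_of_relation hp.2.2.1 hab h)).1
  · intro h
    refine ⟨1, 10 * p 0 ^ 10, by simp, ?_⟩
    rw [gradient_eq_smul_of_mem_ell h, one_smul, ← add_smul]
    simp

/-- Proposition 3.2: `∇F` never vanishes on `M⁴`; `∇F(p)` and `∇G(p)` are linearly
dependent exactly at the points of `ℓ₋ ∪ ℓ₊`; hence they are linearly independent on
`M̃⁴`, which is therefore a regular hypersurface-pair level set. -/
theorem statement_13 :
    (∀ p ∈ M4, gradient Fq p ≠ 0) ∧
    (∀ p ∈ M4,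
      (∃ a b : ℝ, ¬(a = 0 ∧ b = 0) ∧ a • gradient Fq p + b • gradient Gq p = 0) ↔
        p ∈ ellM ∪ ellP) ∧
    (∀ p ∈ Mt4, LinearIndependent ℝ ![gradient Fq p, gradient Gq p]) := by
  refine ⟨fun p hp h => ?_, fun p hp => gradient_relation_iff_mem_ell hp, fun p hp => ?_⟩
  · exact (mem_ell_of_gradient_eq_smul hp (l := 0) (by rw [h, zero_smul])).2 rfl
  · rw [LinearIndependent.pair_iff]
    intro a b h
    by_contra hab
    exact hp.2 ((gradient_relation_iff_mem_ell hp.1).mp ⟨a, b, hab, h⟩)
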